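/- arXiv:1712.08999 — 2 statements merged into one kernel-verified Lean document; each statement's English description precedes it below -/
import Mathlib

section
/- Let S be the 6-vertex simple graph with vertex set {z, v1, v2, v3, v4, v5} whose edges are exactly those of the 5-cycle v1 v2 v3 v4 v5 v1 together with the two edges z v1 and z v2. Let L be a list assignment for S with |L(v1)| ≥ 3, |L(v2)| ≥ 3, and |L(v3)|, |L(v4)|, |L(v5)|, |L(z)| ≥ 2, and let M_L be any matching assignment over L. Then S admits an M_L-coloring, i.e., the cover of S determined by M_L contains an independent set of size 6. -/
/-- A matching assignment over a list assignment `L` for a graph `G`: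
to each edge `uv` of `G` it assigns a (possibly empty) matching between
`{u} × L u` and `{v} × L v`.  We record it as a relation `M u v c c'`
meaning `(u,c)` is matched to `(v,c')`. -/
def IsMatchingAssignment {V : Type*} (G : SimpleGraph V) (L : V → Finset ℕ)
    (M : V → V → ℕ → ℕ → Prop) : Prop :=
  (∀ u v c c', M u v c c' → G.Adj u v ∧ c ∈ L u ∧ c' ∈ L v) ∧
  (∀ u v c c', M u v c c' → M v u c' c) ∧
  (∀ u v c c₁ c₂, M u v c c₁ → M u v c c₂ → c₁ = c₂) ∧
  (∀ u v c₁ c₂ c, M u v c₁ c → M u v c₂ c → c₁ = c₂)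

/-- An `M_L`-coloring of `G`, i.e. an independent set of size `|V(G)|` in the
`M_L`-cover of `G`, recorded by its system of representatives `f`. -/
def IsDPColoring {V : Type*} (G : SimpleGraph V) (L : V → Finset ℕ)
    (M : V → V → ℕ → ℕ → Prop) (f : V → ℕ) : Prop :=
  (∀ v, f v ∈ L v) ∧ ∀ u v, G.Adj u v → ¬ M u v (f u) (f v)

/-- The 6-vertex graph `S` of Claim 1: vertices `z = 0`, `v₁ = 1`, …, `v₅ = 5`;
edges are those of the 5-cycle `v₁v₂v₃v₄v₅v₁` together with `z v₁` and `z v₂`. -/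
def claimGraph : SimpleGraph (Fin 6) :=
  SimpleGraph.fromEdgeSet {s(1, 2), s(2, 3), s(3, 4), s(4, 5), s(5, 1), s(0, 1), s(0, 2)}

theorem Finset.exists_mem_not_of_two_le_card {α : Type*} {s : Finset α} (hs : 2 ≤ s.card)
    {P : α → Prop} (hP : ∀ a b, P a → P b → a = b) : ∃ a ∈ s, ¬ P a := by
  obtain ⟨a, ha, b, hb, hab⟩ := Finset.one_lt_card.mp hs
  by_cases h : P a
  · exact ⟨b, hb, fun h' => hab (hP a b h h')⟩
  · exact ⟨a, ha, h⟩

theorem Finset.exists_mem_not_and_not_of_three_le_card {α : Type*} {s : Finset α}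
    (hs : 3 ≤ s.card) {P Q : α → Prop} (hP : ∀ a b, P a → P b → a = b)
    (hQ : ∀ a b, Q a → Q b → a = b) : ∃ a ∈ s, ¬ P a ∧ ¬ Q a := by
  obtain ⟨a, b, c, ha, hb, hc, hab, hac, hbc⟩ := Finset.two_lt_card_iff.mp hs
  by_contra! h
  by_cases P a <;> by_cases P b <;> by_cases P c <;> grind

/-- Claim 1: if `|L(v₁)|, |L(v₂)| ≥ 3` and `|L(v₃)|, |L(v₄)|, |L(v₅)|, |L(z)| ≥ 2`,
then `S` admits an `M_L`-coloring for every matching assignment `M_L` over `L`. -/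
theorem claimGraph_dpColoring (L : Fin 6 → Finset ℕ)
    (h1 : 3 ≤ (L 1).card) (h2 : 3 ≤ (L 2).card)
    (h3 : 2 ≤ (L 3).card) (h4 : 2 ≤ (L 4).card) (h5 : 2 ≤ (L 5).card)
    (hz : 2 ≤ (L 0).card)
    (M : Fin 6 → Fin 6 → ℕ → ℕ → Prop)
    (hM : IsMatchingAssignment claimGraph L M) :
    ∃ f : Fin 6 → ℕ, IsDPColoring claimGraph L M f := by
  obtain ⟨-, hsymm, hright, -⟩ := hM
  have huniq (u v : Fin 6) (c : ℕ) : ∀ a b, M u v c a → M u v c b → a = b :=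
    fun a b => hright u v c a b
  obtain ⟨a, ha, b, hb, hab⟩ := Finset.one_lt_card.mp hz
  obtain ⟨c₁, hc₁, h1a, h1b⟩ :=
    Finset.exists_mem_not_and_not_of_three_le_card h1 (huniq 0 1 a) (huniq 0 1 b)
  obtain ⟨c₅, hc₅, h15⟩ := Finset.exists_mem_not_of_two_le_card h5 (huniq 1 5 c₁)
  obtain ⟨c₄, hc₄, h54⟩ := Finset.exists_mem_not_of_two_le_card h4 (huniq 5 4 c₅)
  obtain ⟨c₃, hc₃, h43⟩ := Finset.exists_mem_not_of_two_le_card h3 (huniq 4 3 c₄)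
  obtain ⟨c₂, hc₂, h12, h32⟩ :=
    Finset.exists_mem_not_and_not_of_three_le_card h2 (huniq 1 2 c₁) (huniq 3 2 c₃)
  obtain ⟨c₀, hc₀, h20⟩ := Finset.exists_mem_not_of_two_le_card
    (Finset.card_pair hab).ge (huniq 2 0 c₂)
  have hc₀_mem : c₀ ∈ L 0 := by grind
  have h01 : ¬ M 0 1 c₀ c₁ := by grind
  refine ⟨![c₀, c₁, c₂, c₃, c₄, c₅], ?_, ?_⟩
  · intro v
    fin_cases v <;> assumption
  · intro u v huv h
    have h' := hsymm _ _ _ _ h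
    simp only [claimGraph, SimpleGraph.fromEdgeSet_adj, Set.mem_insert_iff,
      Set.mem_singleton_iff, Sym2.eq_iff] at huv
    obtain ⟨huv, -⟩ := huv
    rcases huv with (⟨rfl, rfl⟩ | ⟨rfl, rfl⟩) | (⟨rfl, rfl⟩ | ⟨rfl, rfl⟩) |
      (⟨rfl, rfl⟩ | ⟨rfl, rfl⟩) | (⟨rfl, rfl⟩ | ⟨rfl, rfl⟩) | (⟨rfl, rfl⟩ | ⟨rfl, rfl⟩) |
      (⟨rfl, rfl⟩ | ⟨rfl, rfl⟩) | (⟨rfl, rfl⟩ | ⟨rfl, rfl⟩) <;>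
      first
      | exact h12 h | exact h12 h' | exact h32 h | exact h32 h' | exact h43 h | exact h43 h'
      | exact h54 h | exact h54 h' | exact h15 h | exact h15 h' | exact h01 h | exact h01 h'
      | exact h20 h | exact h20 h'
end

section
/- Let G be a finite simple graph containing six distinct vertices z, v1, v2, v3, v4, v5, each of degree exactly 4 in G, such that the subgraph of G induced on S = {z, v1, v2, v3, v4, v5} has edge set exactly the 5-cycle v1 v2 v3 v4 v5 v1 together with the two edges z v1 and z v2. If the graph G − S obtained by deleting the six vertices of S is DP-4-colorable, then G is DP-4-colorable. -/
/-- `G` is DP-`k`-colorable if for every list assignment with lists of size at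
least `k` and every matching assignment over it, `G` admits an `M_L`-coloring. -/
def DPColorable {V : Type*} (G : SimpleGraph V) (k : ℕ) : Prop :=
  ∀ L : V → Finset ℕ, (∀ v, k ≤ (L v).card) →
    ∀ M : V → V → ℕ → ℕ → Prop, IsMatchingAssignment G L M →
      ∃ f : V → ℕ, IsDPColoring G L M f

open Classical in
/-- In a matching assignment each coloured vertex excludes at most one colour at a given vertex. -/
theorem IsMatchingAssignment.card_le_card_filter_add_card {V : Type*} {G : SimpleGraph V}
    {L : V → Finset ℕ} {M : V → V → ℕ → ℕ → Prop} (hM : IsMatchingAssignment G L M)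
    (v : V) (T : Finset ℕ) (F : Finset (V × ℕ)) :
    T.card ≤ (T.filter fun c => ∀ p ∈ F, ¬ M p.1 v p.2 c).card + F.card := by
  rw [← Finset.card_filter_add_card_filter_not (s := T) fun c => ∀ p ∈ F, ¬ M p.1 v p.2 c]
  gcongr
  have hblock : ∀ c ∈ T.filter (fun c => ¬ ∀ p ∈ F, ¬ M p.1 v p.2 c),
      ∃ p ∈ F, M p.1 v p.2 c := by
    intro c hc
    simpa using (Finset.mem_filter.1 hc).2
  have : Nonempty (V × ℕ) := ⟨(v, 0)⟩
  choose! φ hφ using hblock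
  refine Finset.card_le_card_of_injOn φ (fun c hc => (hφ c hc).1) fun c hc d hd hcd => ?_
  have hd' := (hφ d hd).2
  rw [← hcd] at hd'
  exact hM.2.2.1 _ _ _ _ _ (hφ c hc).2 hd'

/-- If fewer coloured vertices than available colours are given, some colour is matched to none of
them. -/
theorem IsMatchingAssignment.exists_mem_forall_not {V : Type*} {G : SimpleGraph V}
    {L : V → Finset ℕ} {M : V → V → ℕ → ℕ → Prop} (hM : IsMatchingAssignment G L M)
    (v : V) (T : Finset ℕ) (F : Finset (V × ℕ)) (hF : F.card < T.card) :
    ∃ c ∈ T, ∀ p ∈ F, ¬ M p.1 v p.2 c := by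
  classical
  have hcard := hM.card_le_card_filter_add_card v T F
  obtain ⟨c, hc⟩ := Finset.card_pos.1 (show 0 < (T.filter fun c => ∀ p ∈ F, ¬ M p.1 v p.2 c).card
    by omega)
  exact ⟨c, (Finset.mem_filter.1 hc).1, (Finset.mem_filter.1 hc).2⟩

/-- A DP-colouring of an induced subgraph, extended by arbitrary values, respects the cover on all
edges inside that subgraph. -/
theorem DPColorable.exists_coloring_on {V : Type*} {G : SimpleGraph V} {k : ℕ} {A : Set V}
    (h : DPColorable (G.induce A) k) {L : V → Finset ℕ} (hL : ∀ v, k ≤ (L v).card)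
    {M : V → V → ℕ → ℕ → Prop} (hM : IsMatchingAssignment G L M) :
    ∃ g : V → ℕ, (∀ v ∈ A, g v ∈ L v) ∧ ∀ u ∈ A, ∀ v ∈ A, ¬ M u v (g u) (g v) := by
  classical
  obtain ⟨f, hfL, hfM⟩ := h (fun v => L v) (fun v => hL v) (fun u v => M u v)
    ⟨fun u v => hM.1 u v, fun u v => hM.2.1 u v, fun u v => hM.2.2.1 u v,
      fun u v => hM.2.2.2 u v⟩
  refine ⟨fun v => if hv : v ∈ A then f ⟨v, hv⟩ else 0, fun v hv => ?_, fun u hu v hv huv => ?_⟩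
  · simpa [hv] using hfL ⟨v, hv⟩
  · simp only [hu, hv, dif_pos] at huv
    exact hfM ⟨u, hu⟩ ⟨v, hv⟩ (hM.1 _ _ _ _ huv).1 huv

/-- Deleting a set that contains `t` neighbours of `v` leaves at most `degree v - t` of them. -/
theorem SimpleGraph.card_neighborFinset_sdiff_add_card_le {V : Type*} [Fintype V] [DecidableEq V]
    (G : SimpleGraph V) [DecidableRel G.Adj] (v : V) (S T : Finset V) (hTS : T ⊆ S)
    (hT : ∀ u ∈ T, G.Adj v u) : (G.neighborFinset v \ S).card + T.card ≤ G.degree v := by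
  rw [← G.card_neighborFinset_eq_degree, ← Finset.card_union_of_disjoint]
  · refine Finset.card_le_card (Finset.union_subset Finset.sdiff_subset fun u hu => ?_)
    simpa using hT u hu
  · exact Finset.disjoint_of_subset_right hTS Finset.sdiff_disjoint

/-- Lemma 4 (graph-theoretic content): suppose `G` contains six distinct vertices
`z, v₁, …, v₅`, each of degree exactly `4` in `G`, inducing exactly the 5-cycle
`v₁v₂v₃v₄v₅v₁` plus the edges `z v₁` and `z v₂`.  If `G - S` is DP-`4`-colorable,
then so is `G`. -/
theorem dpColorable_of_deleteSmallConfig {V : Type*} [Fintype V] [DecidableEq V]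
    (G : SimpleGraph V) [DecidableRel G.Adj] (z v₁ v₂ v₃ v₄ v₅ : V)
    (hdist : [z, v₁, v₂, v₃, v₄, v₅].Nodup)
    (hdz : G.degree z = 4) (hd1 : G.degree v₁ = 4) (hd2 : G.degree v₂ = 4)
    (hd3 : G.degree v₃ = 4) (hd4 : G.degree v₄ = 4) (hd5 : G.degree v₅ = 4)
    (e12 : G.Adj v₁ v₂) (e23 : G.Adj v₂ v₃) (e34 : G.Adj v₃ v₄)
    (e45 : G.Adj v₄ v₅) (e51 : G.Adj v₅ v₁)
    (ez1 : G.Adj z v₁) (ez2 : G.Adj z v₂)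
    (nz3 : ¬ G.Adj z v₃) (nz4 : ¬ G.Adj z v₄) (nz5 : ¬ G.Adj z v₅)
    (n13 : ¬ G.Adj v₁ v₃) (n14 : ¬ G.Adj v₁ v₄) (n24 : ¬ G.Adj v₂ v₄)
    (n25 : ¬ G.Adj v₂ v₅) (n35 : ¬ G.Adj v₃ v₅)
    (h : DPColorable (G.induce (({z, v₁, v₂, v₃, v₄, v₅} : Set V)ᶜ)) 4) :
    DPColorable G 4 := by
  intro L hL M hM
  obtain ⟨g, hgL, hgM⟩ := h.exists_coloring_on hL hM
  simp only [List.nodup_cons, List.mem_cons, List.not_mem_nil, or_false, not_or,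
    not_false_eq_true, List.nodup_nil, and_true] at hdist
  obtain ⟨⟨dz1, dz2, dz3, dz4, dz5⟩, ⟨d12, d13, d14, d15⟩, ⟨d23, d24, d25⟩, ⟨d34, d35⟩, d45⟩ :=
    hdist
  let S : Finset V := {z, v₁, v₂, v₃, v₄, v₅}
  let B : V → Finset (V × ℕ) := fun v => (G.neighborFinset v \ S).image fun u => (u, g u)
  have hB : ∀ v u, G.Adj v u → u ∉ S → (u, g u) ∈ B v := fun v u hvu hu =>
    Finset.mem_image_of_mem _ (by simpa using ⟨hvu, hu⟩)
  have hBcard : ∀ v, ∀ T ⊆ S, (∀ u ∈ T, G.Adj v u) → (B v).card + T.card ≤ G.degree v :=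
    fun v T hTS hT => (Nat.add_le_add_right Finset.card_image_le _).trans
      (G.card_neighborFinset_sdiff_add_card_le v S T hTS hT)
  have bz : (B z).card ≤ 2 := by
    have := hBcard z {v₁, v₂} (by grind) (by simp [ez1, ez2])
    rw [Finset.card_pair d12] at this
    omega
  have b1 : (B v₁).card ≤ 1 := by
    have := hBcard v₁ {v₂, v₅, z} (by grind) (by simp [e12, e51.symm, ez1.symm])
    rw [Finset.card_eq_three.2 ⟨v₂, v₅, z, d25, Ne.symm dz2, Ne.symm dz5, rfl⟩] at this
    omega
  have b2 : (B v₂).card ≤ 1 := by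
    have := hBcard v₂ {v₁, v₃, z} (by grind) (by simp [e12.symm, e23, ez2.symm])
    rw [Finset.card_eq_three.2 ⟨v₁, v₃, z, d13, Ne.symm dz1, Ne.symm dz3, rfl⟩] at this
    omega
  have b3 : (B v₃).card ≤ 2 := by
    have := hBcard v₃ {v₂, v₄} (by grind) (by simp [e23.symm, e34])
    rw [Finset.card_pair d24] at this
    omega
  have b4 : (B v₄).card ≤ 2 := by
    have := hBcard v₄ {v₃, v₅} (by grind) (by simp [e34.symm, e45])
    rw [Finset.card_pair d35] at this
    omega
  have b5 : (B v₅).card ≤ 2 := by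
    have := hBcard v₅ {v₁, v₄} (by grind) (by simp [e51, e45.symm])
    rw [Finset.card_pair d14] at this
    omega
  -- Two colours of `z` are reserved, and `v₁` avoids both of them.
  obtain ⟨T, hTL, hTcard⟩ : ∃ T : Finset ℕ,
      (∀ c ∈ T, c ∈ L z ∧ ∀ p ∈ B z, ¬ M p.1 z p.2 c) ∧ T.card = 2 := by
    classical
    have hcard := hM.card_le_card_filter_add_card z (L z) (B z)
    have := hL z
    obtain ⟨T, hT, hTcard⟩ := Finset.exists_subset_card_eq
      (show 2 ≤ ((L z).filter fun c => ∀ p ∈ B z, ¬ M p.1 z p.2 c).card by omega)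
    exact ⟨T, fun c hc => Finset.mem_filter.1 (hT hc), hTcard⟩
  obtain ⟨c₁, hc₁, a₁⟩ := hM.exists_mem_forall_not v₁ (L v₁) (B v₁ ∪ T.image fun c => (z, c)) (by
    have := Finset.card_union_le (B v₁) (T.image fun c => (z, c))
    have := Finset.card_image_le (s := T) (f := fun c => (z, c))
    have := hL v₁
    omega)
  have step : ∀ v p, (B v).card ≤ 2 → ∃ c ∈ L v, ∀ q ∈ insert p (B v), ¬ M q.1 v q.2 c :=
    fun v p hv => hM.exists_mem_forall_not v (L v) _ (by
      have := Finset.card_insert_le p (B v)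
      have := hL v
      omega)
  obtain ⟨c₅, hc₅, a₅⟩ := step v₅ (v₁, c₁) b5
  obtain ⟨c₄, hc₄, a₄⟩ := step v₄ (v₅, c₅) b4
  obtain ⟨c₃, hc₃, a₃⟩ := step v₃ (v₄, c₄) b3
  obtain ⟨c₂, hc₂, a₂⟩ := hM.exists_mem_forall_not v₂ (L v₂)
    (insert (v₁, c₁) (insert (v₃, c₃) (B v₂))) (by
      have := Finset.card_insert_le (v₁, c₁) (insert (v₃, c₃) (B v₂))
      have := Finset.card_insert_le (v₃, c₃) (B v₂)
      have := hL v₂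
      omega)
  obtain ⟨c, hcT, a⟩ := hM.exists_mem_forall_not z T {(v₂, c₂)} (by simp [hTcard])
  obtain ⟨hcL, az⟩ := hTL c hcT
  have m1z : ¬ M z v₁ c c₁ :=
    a₁ (z, c) (Finset.mem_union_right _ (Finset.mem_image_of_mem _ hcT))
  have m2z : ¬ M v₂ z c₂ c := a (v₂, c₂) (Finset.mem_singleton_self _)
  have m15 : ¬ M v₁ v₅ c₁ c₅ := a₅ (v₁, c₁) (by simp)
  have m54 : ¬ M v₅ v₄ c₅ c₄ := a₄ (v₅, c₅) (by simp)
  have m43 : ¬ M v₄ v₃ c₄ c₃ := a₃ (v₄, c₄) (by simp)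
  have m32 : ¬ M v₃ v₂ c₃ c₂ := a₂ (v₃, c₃) (by simp)
  have m12 : ¬ M v₁ v₂ c₁ c₂ := a₂ (v₁, c₁) (by simp)
  let f : V → ℕ := fun x => if x = z then c else if x = v₁ then c₁ else if x = v₂ then c₂ else
    if x = v₃ then c₃ else if x = v₄ then c₄ else if x = v₅ then c₅ else g x
  have fz : f z = c := by grind
  have f1 : f v₁ = c₁ := by grind
  have f2 : f v₂ = c₂ := by grind
  have f3 : f v₃ = c₃ := by grind
  have f4 : f v₄ = c₄ := by grind
  have f5 : f v₅ = c₅ := by grind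
  have fg : ∀ x, x ∉ S → f x = g x := by grind
  have hS : ∀ x ∈ S, x = z ∨ x = v₁ ∨ x = v₂ ∨ x = v₃ ∨ x = v₄ ∨ x = v₅ := by simp [S]
  have hSc : ∀ x, x ∉ S → x ∈ ({z, v₁, v₂, v₃, v₄, v₅} : Set V)ᶜ := by simp [S]
  have hout : ∀ v ∈ S, ∀ u, u ∉ S → ¬ M u v (f u) (f v) := by
    intro v hv u hu huv
    have hmem := hB v u (hM.1 _ _ _ _ huv).1.symm hu
    rw [fg u hu] at huv
    rcases hS v hv with rfl | rfl | rfl | rfl | rfl | rfl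
    · exact az _ hmem (fz ▸ huv)
    · exact a₁ _ (Finset.mem_union_left _ hmem) (f1 ▸ huv)
    · exact a₂ _ (Finset.mem_insert_of_mem (Finset.mem_insert_of_mem hmem)) (f2 ▸ huv)
    · exact a₃ _ (Finset.mem_insert_of_mem hmem) (f3 ▸ huv)
    · exact a₄ _ (Finset.mem_insert_of_mem hmem) (f4 ▸ huv)
    · exact a₅ _ (Finset.mem_insert_of_mem hmem) (f5 ▸ huv)
  refine ⟨f, fun v => ?_, fun u v huv hm => ?_⟩
  · by_cases hv : v ∈ S
    · rcases hS v hv with rfl | rfl | rfl | rfl | rfl | rfl <;> simp only [*]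
    · exact fg v hv ▸ hgL v (hSc v hv)
  by_cases hu : u ∈ S <;> by_cases hv : v ∈ S
  · have hm' := hM.2.1 _ _ _ _ hm
    have hvu := huv.symm
    rcases hS u hu with rfl | rfl | rfl | rfl | rfl | rfl <;>
      rcases hS v hv with rfl | rfl | rfl | rfl | rfl | rfl <;>
      simp_all only [SimpleGraph.irrefl]
  · exact hout u hu v hv (hM.2.1 _ _ _ _ hm)
  · exact hout v hv u hu hm
  · rw [fg u hu, fg v hv] at hm
    exact hgM u (hSc u hu) v (hSc v hv) hm
end
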